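/- For every real number n > 0, the identity Ψ₂(n) = √(2/n)·Φ₂(1/n) − Φ₂(n) holds, where Φ₂(a) = ∫₀^∞ cos(π a x²)/(1 + 2·cosh(2π x/√3)) dx and Ψ₂(a) = ∫₀^∞ sin(π a x²)/(1 + 2·cosh(2π x/√3)) dx. -/

import Mathlib

open Real MeasureTheory

noncomputable def Phi2 (a : ℝ) : ℝ :=
  ∫ x in Set.Ioi (0:ℝ), Real.cos (π * a * x ^ 2) / (1 + 2 * Real.cosh (2 * π * x / Real.sqrt 3))

noncomputable def Psi2 (a : ℝ) : ℝ :=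
  ∫ x in Set.Ioi (0:ℝ), Real.sin (π * a * x ^ 2) / (1 + 2 * Real.cosh (2 * π * x / Real.sqrt 3))

open Filter Topology

noncomputable def xx (s : ℝ) : ℂ := (1 + Complex.I * s) / 3

lemma xx_mem (s : ℝ) : xx s ∈ Complex.integerComplement := by
  rintro ⟨n, hn⟩
  have h := congrArg Complex.re hn
  simp [xx] at h
  have h3 : (3 * n : ℝ) = 1 := by rw [h]; norm_num
  have : (3 * n : ℤ) = 1 := by exact_mod_cast h3
  omega

noncomputable def aa (s : ℝ) (k : ℕ) : ℂ :=
  1 / (xx s + k) + 1 / (xx (-s) + k) - 1 / (k + 1 - xx s) - 1 / (k + 1 - xx (-s))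

lemma tendsto_inv_add (x : ℂ) : Tendsto (fun N : ℕ => 1 / (x + N)) atTop (𝓝 0) := by
  have h : Tendsto (fun N : ℕ => x + (N:ℂ)) atTop (Bornology.cobounded ℂ) := by
    rw [← tendsto_norm_atTop_iff_cobounded]
    have h0 : Tendsto (fun N : ℕ => (N:ℝ) + -‖x‖) atTop atTop :=
      tendsto_atTop_add_const_right _ _ tendsto_natCast_atTop_atTop
    refine tendsto_atTop_mono (fun N => ?_) h0
    have := norm_sub_le (x + (N:ℂ)) x
    simp at this
    linarith
  have := tendsto_inv₀_cobounded.comp h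
  simpa [Function.comp_def] using this

lemma sum_aa (s : ℝ) (N : ℕ) : ∑ k ∈ Finset.range N, aa s k =
    1 / xx s + 1 / xx (-s) + (∑ j ∈ Finset.range N, cotTerm (xx s) j + ∑ j ∈ Finset.range N, cotTerm (xx (-s)) j)
      - (1 / (xx s + N) + 1 / (xx (-s) + N)) := by
  induction N with
  | zero => simp
  | succ N ih =>
    rw [Finset.sum_range_succ, Finset.sum_range_succ, Finset.sum_range_succ, ih]
    simp only [aa, cotTerm]
    generalize (∑ j ∈ Finset.range N, (1 / (xx s - (j + 1)) + 1 / (xx s + (j + 1)))) = X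
    generalize (∑ j ∈ Finset.range N, (1 / (xx (-s) - (j + 1)) + 1 / (xx (-s) + (j + 1)))) = Y
    have e : ∀ x : ℂ, 1 / ((N:ℂ) + 1 - x) = - (1 / (x - (N + 1))) := by
      intro x
      rw [← neg_sub, div_neg]
    rw [e, e]
    push_cast
    ring

lemma tendsto_aa (s : ℝ) : Tendsto (fun N => ∑ k ∈ Finset.range N, aa s k) atTop
    (𝓝 (π * Complex.cot (π * xx s) + π * Complex.cot (π * xx (-s)))) := by
  simp_rw [sum_aa]
  have := ((((tendsto_logDeriv_euler_cot_sub (xx_mem s)).add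
    (tendsto_logDeriv_euler_cot_sub (xx_mem (-s)))).const_add (1 / xx s + 1 / xx (-s)))).sub
    ((tendsto_inv_add (xx s)).add (tendsto_inv_add (xx (-s))))
  convert this using 2
  ring

lemma cot_sum (s : ℝ) : (π * Complex.cot (π * xx s) + π * Complex.cot (π * xx (-s)) : ℂ)
    = ((2 * π * √3 / (1 + 2 * Real.cosh (2 * π * s / 3)) : ℝ) : ℂ) := by
  have h1 := sin_pi_mul_ne_zero (xx_mem s)
  have h2 := sin_pi_mul_ne_zero (xx_mem (-s))
  have hadd : (π * xx s + π * xx (-s) : ℂ) = ((2 * π / 3 : ℝ) : ℂ) := by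
    simp [xx]; ring
  have hsub : (π * xx s - π * xx (-s) : ℂ) = ((2 * π * s / 3 : ℝ) : ℂ) * Complex.I := by
    simp [xx]; ring
  have c1 := Complex.cos_add (π * xx s) (π * xx (-s))
  have c2 := Complex.cos_sub (π * xx s) (π * xx (-s))
  have s1 := Complex.sin_add (π * xx s) (π * xx (-s))
  rw [hadd, ← Complex.ofReal_cos] at c1
  rw [hadd, ← Complex.ofReal_sin] at s1
  rw [hsub, Complex.cos_mul_I, ← Complex.ofReal_cosh] at c2
  have e : 2 * π / 3 = π - π / 3 := by ring
  rw [e, Real.cos_pi_sub, Real.cos_pi_div_three] at c1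
  rw [e, Real.sin_pi_sub, Real.sin_pi_div_three] at s1
  have hpos : (1 + 2 * (Real.cosh (2 * π * s / 3) : ℂ)) ≠ 0 := by
    have : 0 < 1 + 2 * Real.cosh (2 * π * s / 3) := by
      have := Real.cosh_pos (2 * π * s / 3); positivity
    exact_mod_cast this.ne'
  rw [Complex.cot_eq_cos_div_sin, Complex.cot_eq_cos_div_sin]
  rw [Complex.ofReal_div]
  simp only [Complex.ofReal_mul, Complex.ofReal_add, Complex.ofReal_one, Complex.ofReal_ofNat,
    Complex.ofReal_neg, Complex.ofReal_div] at *
  generalize Complex.sin (π * xx s) = S at *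
  generalize Complex.sin (π * xx (-s)) = S' at *
  generalize Complex.cos (π * xx s) = C at *
  generalize Complex.cos (π * xx (-s)) = C' at *
  generalize (Real.cosh (2 * π * s / 3) : ℂ) = K at *
  have hK : 1 + 2 * K = 4 * (S * S') := by linear_combination 2 * c2 - 2 * c1
  rw [hK]
  field_simp
  linear_combination -4 * s1

noncomputable def uu : ℝ := 2 * π / √3

lemma uu_pos : 0 < uu := by unfold uu; positivity

noncomputable def HH (x : ℝ) : ℝ := 1 / (1 + 2 * Real.cosh (uu * x))

lemma HH_den_pos (x : ℝ) : 0 < 1 + 2 * Real.cosh (uu * x) := by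
  have := Real.cosh_pos (uu * x); positivity

lemma HH_nonneg (x : ℝ) : 0 ≤ HH x := by
  unfold HH
  have := HH_den_pos x
  positivity

lemma HH_neg (x : ℝ) : HH (-x) = HH x := by simp [HH]

lemma HH_cont : Continuous HH := by
  unfold HH
  exact continuous_const.div (by fun_prop) (fun x => (HH_den_pos x).ne')

lemma HH_le (x : ℝ) : HH x ≤ Real.exp (-uu * x) := by
  unfold HH
  rw [div_le_iff₀ (HH_den_pos x), Real.cosh_eq]
  have : Real.exp (-uu * x) * Real.exp (uu * x) = 1 := by
    rw [← Real.exp_add]; simp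
  have h1 := Real.exp_pos (-uu * x)
  have h2 := Real.exp_pos (-(uu * x))
  nlinarith [mul_pos h1 h2]

lemma HH_intOn : IntegrableOn HH (Set.Ioi 0) := by
  refine Integrable.mono' (g := fun x => Real.exp (-uu * x)) ?_ HH_cont.aestronglyMeasurable ?_
  · exact integrableOn_exp_mul_Ioi (by linarith [uu_pos]) 0
  · filter_upwards with x
    rw [Real.norm_of_nonneg (HH_nonneg x)]
    exact HH_le x

lemma HH_int : Integrable HH := by
  rw [← integrableOn_univ, ← Set.Iic_union_Ioi (a := (0:ℝ))]
  refine IntegrableOn.union ?_ HH_intOn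
  have := HH_intOn.comp_neg
  simp only [HH_neg, Set.neg_Ioi, neg_zero] at this
  exact integrableOn_Iic_iff_integrableOn_Iio (by simp) |>.2 this

lemma HH_hasSum (x : ℝ) (hx : 0 < x) :
    HasSum (fun k : ℕ => Real.exp (-((3 * k + 1) * uu) * x) - Real.exp (-((3 * k + 2) * uu) * x)) (HH x) := by
  set q := Real.exp (-uu * x) with hq
  have q0 : 0 < q := Real.exp_pos _
  have q1 : q < 1 := by
    rw [hq, Real.exp_lt_one_iff]
    have := mul_pos uu_pos hx
    linarith
  have q3 : q ^ 3 < 1 := pow_lt_one₀ q0.le q1 (by norm_num)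
  have hg := (hasSum_geometric_of_lt_one (by positivity) q3).mul_left (q - q ^ 2)
  have hne : 1 - q ^ 3 ≠ 0 := by linarith
  have hf : (fun k : ℕ => Real.exp (-((3 * k + 1) * uu) * x) - Real.exp (-((3 * k + 2) * uu) * x))
      = fun k => (q - q ^ 2) * (q ^ 3) ^ k := by
    funext k
    have e1 : Real.exp (-((3 * k + 1) * uu) * x) = q ^ (3 * k + 1) := by
      rw [hq, ← Real.exp_nat_mul]; push_cast; ring_nf
    have e2 : Real.exp (-((3 * k + 2) * uu) * x) = q ^ (3 * k + 2) := by
      rw [hq, ← Real.exp_nat_mul]; push_cast; ring_nf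
    rw [e1, e2]; ring
  have hv : HH x = (q - q ^ 2) * (1 - q ^ 3)⁻¹ := by
    unfold HH
    rw [Real.cosh_eq]
    have e1 : Real.exp (uu * x) = q⁻¹ := by rw [hq, ← Real.exp_neg]; ring_nf
    have e2 : Real.exp (-(uu * x)) = q := by rw [hq]; ring_nf
    rw [e1, e2]
    have : 1 + 2 * ((q⁻¹ + q) / 2) ≠ 0 := by positivity
    have h2 : q ^ 2 + q + 1 ≠ 0 := by positivity
    rw [← div_eq_mul_inv, div_eq_div_iff this hne]
    field_simp
    ring
  rw [hf, hv]
  exact hg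

noncomputable def FF (w : ℝ) (k : ℕ) (x : ℝ) : ℂ :=
  ((Real.exp (-((3 * k + 1) * uu) * x) - Real.exp (-((3 * k + 2) * uu) * x) : ℝ) : ℂ) *
    (Complex.exp (Complex.I * w * x) + Complex.exp (-Complex.I * w * x))

lemma FF_eq (w : ℝ) (k : ℕ) (x : ℝ) : FF w k x =
    Complex.exp ((-((3 * k + 1) * uu) + Complex.I * w) * x) + Complex.exp ((-((3 * k + 1) * uu) - Complex.I * w) * x)
    - Complex.exp ((-((3 * k + 2) * uu) + Complex.I * w) * x) - Complex.exp ((-((3 * k + 2) * uu) - Complex.I * w) * x) := by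
  unfold FF
  push_cast
  simp only [add_mul, sub_mul, Complex.exp_add, mul_add, sub_eq_add_neg, neg_mul]
  ring

lemma re_aux (k : ℕ) (c : ℝ) (w : ℝ) (hc : 0 < c) :
   (-((3 * k + c) * uu) + Complex.I * w : ℂ).re < 0 ∧ (-((3 * k + c) * uu) - Complex.I * w : ℂ).re < 0 := by
  have := uu_pos
  have : 0 < (3 * k + c) * uu := by positivity
  simp
  linarith

lemma FF_int (w : ℝ) (k : ℕ) : Integrable (FF w k) (volume.restrict (Set.Ioi 0)) := by
  have h1 := re_aux k 1 w one_pos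
  have h2 := re_aux k 2 w two_pos
  push_cast at h1 h2
  have := (((integrableOn_exp_mul_complex_Ioi h1.1 0).add (integrableOn_exp_mul_complex_Ioi h1.2 0)).sub
    (integrableOn_exp_mul_complex_Ioi h2.1 0)).sub (integrableOn_exp_mul_complex_Ioi h2.2 0)
  refine this.congr ?_
  filter_upwards with x
  simp [FF_eq]

lemma uu_mul : (uu : ℂ) * (√3 : ℝ) = 2 * π := by
  have : uu * √3 = 2 * π := by unfold uu; field_simp
  exact_mod_cast this

lemma FF_integral (t : ℝ) (k : ℕ) :
    ∫ x in Set.Ioi (0:ℝ), FF (2 * π * t) k x = 1 / (3 * uu) * aa (√3 * t) k := by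
  have h1 := re_aux k 1 (2 * π * t) one_pos
  have h2 := re_aux k 2 (2 * π * t) two_pos
  simp only [Complex.ofReal_one, Complex.ofReal_ofNat] at h1 h2
  have i1 := integrableOn_exp_mul_complex_Ioi h1.1 0
  have i2 := integrableOn_exp_mul_complex_Ioi h1.2 0
  have i3 := integrableOn_exp_mul_complex_Ioi h2.1 0
  have i4 := integrableOn_exp_mul_complex_Ioi h2.2 0
  simp_rw [FF_eq]
  have j1 := i1.add i2
  have j2 := j1.sub i3
  simp only [Pi.add_def, Pi.sub_def] at j1 j2
  rw [integral_sub j2 i4, integral_sub j1 i3, integral_add i1 i2,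
    integral_exp_mul_complex_Ioi h1.1, integral_exp_mul_complex_Ioi h1.2,
    integral_exp_mul_complex_Ioi h2.1, integral_exp_mul_complex_Ioi h2.2]
  have hu : (uu : ℂ) ≠ 0 := by exact_mod_cast uu_pos.ne'
  have e : ((2 * π * t : ℝ) : ℂ) = uu * (√3 : ℝ) * t := by rw [uu_mul]; push_cast; ring
  have key : ∀ a b : ℂ, a = - (3 * uu * b) → -Complex.exp (a * 0) / a = 1 / (3 * uu) * (1 / b) := by
    rintro a b rfl
    simp
    ring
  rw [e] at *
  unfold aa xx
  push_cast
  simp only [mul_sub, mul_add (1 / (3 * (uu:ℂ)))]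
  have k1 := key (-((3 * k + 1) * uu) + Complex.I * (uu * (√3 : ℝ) * t)) ((1 + Complex.I * -((√3:ℝ) * t)) / 3 + k) (by ring)
  have k2 := key (-((3 * k + 1) * uu) - Complex.I * (uu * (√3 : ℝ) * t)) ((1 + Complex.I * ((√3:ℝ) * t)) / 3 + k) (by ring)
  have k3 := key (-((3 * k + 2) * uu) + Complex.I * (uu * (√3 : ℝ) * t)) (k + 1 - (1 + Complex.I * ((√3:ℝ) * t)) / 3) (by ring)
  have k4 := key (-((3 * k + 2) * uu) - Complex.I * (uu * (√3 : ℝ) * t)) (k + 1 - (1 + Complex.I * -((√3:ℝ) * t)) / 3) (by ring)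
  rw [k1, k2, k3, k4]
  ring

lemma FF_norm (w : ℝ) (k : ℕ) (x : ℝ) (hx : 0 < x) : ‖FF w k x‖ ≤
    2 * (Real.exp (-((3 * k + 1) * uu) * x) - Real.exp (-((3 * k + 2) * uu) * x)) := by
  unfold FF
  rw [norm_mul, Complex.norm_real, Real.norm_of_nonneg, mul_comm]
  · have hnn : 0 ≤ Real.exp (-((3 * k + 1) * uu) * x) - Real.exp (-((3 * k + 2) * uu) * x) := by
      rw [sub_nonneg, Real.exp_le_exp]
      nlinarith [mul_pos uu_pos hx]
    refine mul_le_mul_of_nonneg_right ?_ hnn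
    refine (norm_add_le _ _).trans ?_
    rw [Complex.norm_exp, Complex.norm_exp]
    simp
    norm_num
  · rw [sub_nonneg, Real.exp_le_exp]
    nlinarith [mul_pos uu_pos hx]

lemma FF_summable (w : ℝ) : Summable fun k => ∫ x in Set.Ioi (0:ℝ), ‖FF w k x‖ := by
  have hs : Summable fun k : ℕ => 2 / uu * (1 / ((k:ℝ) + 1) ^ 2) := by
    have := (summable_nat_add_iff 1).2 (Real.summable_one_div_nat_pow.2 one_lt_two)
    simpa using this.mul_left (2 / uu)
  refine Summable.of_nonneg_of_le (fun k => integral_nonneg fun x => norm_nonneg _) (fun k => ?_) hs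
  have hu := uu_pos
  have p1 : -((3 * k + 1) * uu) < 0 := by have : 0 < (3 * k + 1) * uu := by positivity
                                          linarith
  have p2 : -((3 * k + 2) * uu) < 0 := by have : 0 < (3 * k + 2) * uu := by positivity
                                          linarith
  have i1 := integrableOn_exp_mul_Ioi p1 0
  have i2 := integrableOn_exp_mul_Ioi p2 0
  have hle : ∫ x in Set.Ioi (0:ℝ), ‖FF w k x‖ ≤ ∫ x in Set.Ioi (0:ℝ), 
    2 * (Real.exp (-((3 * k + 1) * uu) * x) - Real.exp (-((3 * k + 2) * uu) * x)) := by
    refine setIntegral_mono_on (FF_int w k).norm ((i1.sub i2).const_mul 2) measurableSet_Ioi ?_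
    intro x hx
    exact FF_norm w k x hx
  refine hle.trans ?_
  rw [integral_const_mul, integral_sub i1 i2, integral_exp_mul_Ioi p1, integral_exp_mul_Ioi p2]
  simp only [mul_zero, Real.exp_zero]
  have : 2 * (-1 / -((3 * k + 1) * uu) - -1 / -((3 * k + 2) * uu)) = 2 / uu * (1 / ((3 * k + 1) * (3 * k + 2))) := by
    field_simp
    ring
  rw [this]
  gcongr
  nlinarith [(Nat.cast_nonneg k : (0:ℝ) ≤ k)]

lemma HH_half (t : ℝ) : ∫ x in Set.Ioi (0:ℝ), (HH x : ℂ) *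
    (Complex.exp (Complex.I * (2 * π * t : ℝ) * x) + Complex.exp (-Complex.I * (2 * π * t : ℝ) * x)) = HH t := by
  have h := hasSum_integral_of_summable_integral_norm (FF_int (2 * π * t)) (FF_summable (2 * π * t))
  have e : ∫ x in Set.Ioi (0:ℝ), ∑' k, FF (2 * π * t) k x = ∫ x in Set.Ioi (0:ℝ), (HH x : ℂ) *
    (Complex.exp (Complex.I * (2 * π * t : ℝ) * x) + Complex.exp (-Complex.I * (2 * π * t : ℝ) * x)) := by
    refine setIntegral_congr_fun measurableSet_Ioi ?_
    intro x hx
    exact ((Complex.hasSum_ofReal.2 (HH_hasSum x hx)).mul_right _).tsum_eq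
  rw [e] at h
  have h1 := h.tendsto_sum_nat
  simp_rw [FF_integral, ← Finset.mul_sum] at h1
  have h2 := (tendsto_aa (√3 * t)).const_mul (1 / (3 * (uu:ℂ)))
  rw [tendsto_nhds_unique h1 h2, cot_sum]
  have hp := HH_den_pos t
  have hu := uu_pos
  have e3 : 2 * π * (√3 * t) / 3 = uu * t := by
    unfold uu
    field_simp
    rw [Real.sq_sqrt (by norm_num)]
    ring
  rw [e3]
  have : HH t = 1 / (3 * uu) * (2 * π * √3 / (1 + 2 * Real.cosh (uu * t))) := by
    unfold HH
    have : 2 * π * √3 = 3 * uu := by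
      unfold uu
      field_simp
      rw [Real.sq_sqrt (by norm_num)]
    rw [this]
    field_simp
  rw [this]
  push_cast
  rfl

lemma integral_even_split (f : ℝ → ℂ) (hf : Integrable f) :
    ∫ x, f x = ∫ x in Set.Ioi (0:ℝ), (f x + f (-x)) := by
  have h2 : IntegrableOn (fun x => f (-x)) (Set.Ioi 0) := hf.comp_neg.integrableOn
  rw [integral_add hf.integrableOn h2, integral_comp_neg_Ioi, neg_zero, add_comm,
    intervalIntegral.integral_Iic_add_Ioi hf.integrableOn hf.integrableOn]

lemma HH_fourier : FourierTransform.fourier (fun x : ℝ => (HH x : ℂ)) = fun t : ℝ => (HH t : ℂ) := by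
  funext t
  rw [Real.fourier_real_eq_integral_exp_smul, integral_even_split, ← HH_half t]
  · refine integral_congr_ae ?_
    filter_upwards with x
    rw [HH_neg]
    simp only [smul_eq_mul]
    have e1 : (((-2 * π * x * t : ℝ)) : ℂ) * Complex.I = -Complex.I * (2 * π * t : ℝ) * x := by
      push_cast; ring
    have e2 : (((-2 * π * (-x) * t : ℝ)) : ℂ) * Complex.I = Complex.I * (2 * π * t : ℝ) * x := by
      push_cast; ring
    rw [e1, e2]
    ring
  · have := HH_cont
    refine HH_int.mono' (Continuous.aestronglyMeasurable (by fun_prop)) ?_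
    filter_upwards with x
    rw [norm_smul, Complex.norm_exp_ofReal_mul_I, one_mul, Complex.norm_real,
      Real.norm_of_nonneg (HH_nonneg x)]

lemma parseval (b : ℂ) (hb : 0 < b.re) :
    ∫ x : ℝ, (HH x : ℂ) * Complex.exp (-π * b * x ^ 2) =
    1 / b ^ (1 / 2 : ℂ) * ∫ x : ℝ, (HH x : ℂ) * Complex.exp (-π / b * x ^ 2) := by
  have hg : Integrable (fun x : ℝ => Complex.exp (-π * b * x ^ 2)) := by
    have := integrable_cexp_neg_mul_sq (b := π * b) (by simp; positivity)
    simpa using this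
  have hH : Integrable (fun x : ℝ => (HH x : ℂ)) := HH_int.ofReal
  have h := VectorFourier.integral_fourierIntegral_smul_eq_flip (L := innerₗ ℝ) (μ := volume) (ν := volume)
    Real.continuous_fourierChar continuous_inner hH hg
  rw [flip_innerₗ] at h
  have e1 : VectorFourier.fourierIntegral Real.fourierChar volume (innerₗ ℝ) (fun x : ℝ => (HH x : ℂ)) = fun t : ℝ => (HH t : ℂ) := HH_fourier
  have e2 : VectorFourier.fourierIntegral Real.fourierChar volume (innerₗ ℝ) (fun x : ℝ => Complex.exp (-π * b * x ^ 2)) =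
    fun t : ℝ => 1 / b ^ (1 / 2 : ℂ) * Complex.exp (-π / b * t ^ 2) := fourier_gaussian_pi hb
  rw [e1, e2] at h
  refine Eq.trans ?_ (h.trans ?_)
  · simp_rw [smul_eq_mul]
  · rw [← integral_const_mul]
    refine integral_congr_ae (Eventually.of_forall fun x => ?_)
    simp only [smul_eq_mul]
    ring

lemma tendsto_GG (c : ℝ → ℂ) (c0 : ℂ) (hc : ∀ᶠ ε in 𝓝[>] 0, 0 ≤ (c ε).re)
    (ht : Tendsto c (𝓝[>] 0) (𝓝 c0)) :
    Tendsto (fun ε => ∫ x : ℝ, (HH x : ℂ) * Complex.exp (-π * c ε * x ^ 2)) (𝓝[>] 0)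
      (𝓝 (∫ x : ℝ, (HH x : ℂ) * Complex.exp (-π * c0 * x ^ 2))) := by
  refine tendsto_integral_filter_of_dominated_convergence HH ?_ ?_ HH_int ?_
  · filter_upwards with ε
    have := HH_cont
    exact Continuous.aestronglyMeasurable (by fun_prop)
  · filter_upwards [hc] with ε h
    filter_upwards with x
    rw [norm_mul, Complex.norm_real, Real.norm_of_nonneg (HH_nonneg x), Complex.norm_exp]
    refine mul_le_of_le_one_right (HH_nonneg x) ?_
    rw [Real.exp_le_one_iff]
    have : (-π * c ε * x ^ 2 : ℂ).re = - (π * (c ε).re * x ^ 2) := by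
      rw [← Complex.ofReal_pow, Complex.re_mul_ofReal, ← Complex.ofReal_neg, Complex.re_ofReal_mul]; ring
    rw [this]
    have : 0 ≤ π * (c ε).re * x ^ 2 := by positivity
    linarith
  · filter_upwards with x
    exact (((ht.const_mul _).mul_const _).cexp).const_mul _

lemma limit_id (n : ℝ) (hn : 0 < n) :
    ∫ x : ℝ, (HH x : ℂ) * Complex.exp (-π * (-Complex.I * n) * x ^ 2) =
    1 / (-Complex.I * n) ^ (1 / 2 : ℂ) * ∫ x : ℝ, (HH x : ℂ) * Complex.exp (-π * (-Complex.I * n)⁻¹ * x ^ 2) := by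
  have hne : (-Complex.I * n : ℂ) ≠ 0 := by simp [hn.ne']
  have hc : Tendsto (fun ε : ℝ => (ε : ℂ) + -Complex.I * n) (𝓝[>] 0) (𝓝 (-Complex.I * n)) := by
    have : Continuous (fun ε : ℝ => (ε : ℂ) + -Complex.I * n) := by fun_prop
    have := this.tendsto 0
    simp only [Complex.ofReal_zero, zero_add] at this
    exact this.mono_left nhdsWithin_le_nhds
  have hre : ∀ ε : ℝ, ((ε : ℂ) + -Complex.I * n).re = ε := by intro ε; simp
  have l1 := tendsto_GG _ _ (by
    filter_upwards [self_mem_nhdsWithin] with ε h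
    rw [hre]; exact le_of_lt h) hc
  have l2 := tendsto_GG _ _ (by
    filter_upwards [self_mem_nhdsWithin] with ε h
    rw [Complex.inv_re, hre]
    exact div_nonneg (le_of_lt h) (Complex.normSq_nonneg _)) (hc.inv₀ hne)
  have hp : Tendsto (fun ε : ℝ => 1 / ((ε : ℂ) + -Complex.I * n) ^ (1 / 2 : ℂ)) (𝓝[>] 0)
      (𝓝 (1 / (-Complex.I * n) ^ (1 / 2 : ℂ))) := by
    refine Tendsto.div tendsto_const_nhds ?_ ?_
    · refine (ContinuousAt.tendsto (f := fun z : ℂ => z ^ (1 / 2 : ℂ)) ?_).comp hc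
      refine continuousAt_cpow_const ?_
      right
      simp [hn.ne']
    · rw [Complex.cpow_ne_zero_iff]; left; exact hne
  refine tendsto_nhds_unique l1 ((hp.mul l2).congr' ?_)
  filter_upwards [self_mem_nhdsWithin] with ε h
  exact (parseval _ (by rw [hre]; exact h)).symm

lemma half_int (a : ℝ) : ∫ x : ℝ, (HH x : ℂ) * Complex.exp (Complex.I * (π * a * x ^ 2 : ℝ)) =
    2 * ((Phi2 a : ℂ) + Complex.I * Psi2 a) := by
  have hcont := HH_cont
  have hc : IntegrableOn (fun x => HH x * Real.cos (π * a * x ^ 2)) (Set.Ioi 0) := by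
    refine HH_intOn.mono' (Continuous.aestronglyMeasurable (by fun_prop)) ?_
    filter_upwards with x
    rw [norm_mul, Real.norm_of_nonneg (HH_nonneg x)]
    exact mul_le_of_le_one_right (HH_nonneg x) (Real.abs_cos_le_one _)
  have hs : IntegrableOn (fun x => HH x * Real.sin (π * a * x ^ 2)) (Set.Ioi 0) := by
    refine HH_intOn.mono' (Continuous.aestronglyMeasurable (by fun_prop)) ?_
    filter_upwards with x
    rw [norm_mul, Real.norm_of_nonneg (HH_nonneg x)]
    exact mul_le_of_le_one_right (HH_nonneg x) (Real.abs_sin_le_one _)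
  have eP : Phi2 a = ∫ x in Set.Ioi (0:ℝ), HH x * Real.cos (π * a * x ^ 2) := by
    unfold Phi2 HH uu
    congr 1; funext x; rw [show 2 * π * x / √3 = 2 * π / √3 * x by ring]; ring
  have eS : Psi2 a = ∫ x in Set.Ioi (0:ℝ), HH x * Real.sin (π * a * x ^ 2) := by
    unfold Psi2 HH uu
    congr 1; funext x; rw [show 2 * π * x / √3 = 2 * π / √3 * x by ring]; ring
  rw [integral_even_split]
  · rw [eP, eS, ← integral_complex_ofReal, ← integral_complex_ofReal, ← integral_const_mul,
      ← integral_add hc.ofReal (hs.ofReal.const_mul _), ← integral_const_mul]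
    refine integral_congr_ae (Eventually.of_forall fun x => ?_)
    simp only [HH_neg, neg_sq]
    rw [mul_comm Complex.I, Complex.exp_mul_I, ← Complex.ofReal_cos, ← Complex.ofReal_sin]
    push_cast
    ring
  · refine HH_int.mono' (Continuous.aestronglyMeasurable (by fun_prop)) ?_
    filter_upwards with x
    rw [norm_mul, Complex.norm_real, Real.norm_of_nonneg (HH_nonneg x), mul_comm Complex.I, Complex.norm_exp_ofReal_mul_I, mul_one]

lemma sqrt_neg_I (n : ℝ) (hn : 0 < n) :
    1 / (-Complex.I * n) ^ (1 / 2 : ℂ) = ((1 / √(2 * n) : ℝ) : ℂ) * (1 + Complex.I) := by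
  have hne : (-Complex.I * n : ℂ) ≠ 0 := by simp [hn.ne']
  have hI : Complex.log (-Complex.I * n) = Real.log n + (-(π / 2) : ℝ) * Complex.I := by
    rw [mul_comm, Complex.log_ofReal_mul hn (by simp), Complex.log_neg_I]
    push_cast; ring
  rw [one_div, ← Complex.cpow_neg, Complex.cpow_def_of_ne_zero hne, hI]
  have : ((Real.log n + (-(π / 2) : ℝ) * Complex.I) * -(1 / 2) : ℂ) =
      ((-(Real.log n) / 2 : ℝ) : ℂ) + ((π / 4 : ℝ) : ℂ) * Complex.I := by push_cast; ring
  rw [this, Complex.exp_add, Complex.exp_mul_I, ← Complex.ofReal_cos, ← Complex.ofReal_sin,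
    Real.cos_pi_div_four, Real.sin_pi_div_four, ← Complex.ofReal_exp]
  have e : Real.exp (-(Real.log n) / 2) = 1 / √n := by
    rw [Real.sqrt_eq_rpow, Real.rpow_def_of_pos hn, one_div, ← Real.exp_neg]
    ring_nf
  have e2 : 1 / √n * (√2 / 2) = 1 / √(2 * n) := by
    rw [Real.sqrt_mul (by norm_num)]
    field_simp
    rw [Real.sq_sqrt (by norm_num)]
  rw [e, ← e2]
  push_cast
  ring

theorem stmt3 (n : ℝ) (hn : 0 < n) :
    Psi2 n = Real.sqrt (2 / n) * Phi2 (1 / n) - Phi2 n := by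
  have h := limit_id n hn
  have hn' : (n : ℂ) ≠ 0 := by exact_mod_cast hn.ne'
  have a1 : ∀ x : ℝ, (-π * (-Complex.I * n) * x ^ 2 : ℂ) = Complex.I * (π * n * x ^ 2 : ℝ) := by
    intro x; push_cast; ring
  have a2 : ∀ x : ℝ, (-π * (-Complex.I * n)⁻¹ * x ^ 2 : ℂ) = Complex.I * (π * (-(1 / n)) * x ^ 2 : ℝ) := by
    intro x; rw [mul_inv, inv_neg, Complex.inv_I]; push_cast; ring
  simp_rw [a1, a2] at h
  rw [half_int, half_int, sqrt_neg_I n hn] at h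
  have b1 : Phi2 (-(1 / n)) = Phi2 (1 / n) := by
    unfold Phi2
    congr 1; funext x
    rw [show π * -(1 / n) * x ^ 2 = -(π * (1 / n) * x ^ 2) by ring, Real.cos_neg]
  have b2 : Psi2 (-(1 / n)) = - Psi2 (1 / n) := by
    unfold Psi2
    rw [← integral_neg]
    congr 1; funext x
    rw [show π * -(1 / n) * x ^ 2 = -(π * (1 / n) * x ^ 2) by ring, Real.sin_neg, neg_div]
  rw [b1, b2] at h
  have e : √(2 / n) = 2 * (1 / √(2 * n)) := by
    rw [Real.sqrt_mul (by norm_num), Real.sqrt_div (by norm_num)]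
    field_simp
    rw [Real.sq_sqrt (by norm_num)]
  rw [e]
  generalize 1 / √(2 * n) = A at *
  have hr := congrArg Complex.re h
  have hi := congrArg Complex.im h
  simp [-one_div] at hr hi
  linarith
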